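/- Let m ≥ 2 and let M be an m × n matrix all of whose entries are ±1, whose first row is the all-ones vector, and whose columns are pairwise distinct (so M is m-Hadamardesque and its Column Representation Vector v is a 0-1 vector with exactly n ones). Then the rows of M are pairwise orthogonal (i.e. M is a partial Hadamard matrix) if and only if v lies in the linear span of RC_m. -/

import Mathlib

open Matrix
open scoped Classical

/-- `pidx i j` is the 0-indexed position of the pair `(i,j)`, `i < j`, in the standard
ordering `(0,1),(0,2),(1,2),(0,3),...`; it corresponds to the 1-indexed position
`(j-1)(j-2)/2 + i` of the paper (for 1-indexed pairs `1 ≤ i < j ≤ m`). -/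
def pidx (i j : ℕ) : ℕ := j * (j - 1) / 2 + i

lemma pidx_lt {i j m : ℕ} (hij : i < j) (hjm : j < m) : pidx i j < m * (m - 1) / 2 := by
  have h1 : pidx i j < j * (j - 1) / 2 + j := by unfold pidx; omega
  have h2 : j * (j - 1) / 2 + j = (j + 1) * j / 2 := by
    obtain ⟨j', rfl⟩ : ∃ j', j = j' + 1 := ⟨j - 1, by omega⟩
    have h : (j' + 2) * (j' + 1) = (j' + 1) * j' + (j' + 1) * 2 := by ring
    simp only [Nat.add_sub_cancel]
    rw [show j' + 1 + 1 = j' + 2 from rfl, h,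
      Nat.add_mul_div_right _ _ (by norm_num : 0 < 2)]
  have h3 : (j + 1) * j ≤ m * (m - 1) := Nat.mul_le_mul (by omega) (by omega)
  have h4 := Nat.div_le_div_right (c := 2) h3
  omega

/-- `T_m`: the `m × 2^(m-1)` matrix whose columns are exactly the `2^(m-1)` vectors of
the form `(1, ±1, …, ±1)`: `T_m(0,j) = 1` and `T_m(i,j) = (-1)^(bit_(i-1)(j))` for
`i ≥ 1`. -/
def Tmat (m : ℕ) : Matrix (Fin m) (Fin (2 ^ (m - 1))) ℝ :=
  fun i j => if i.val = 0 then 1 else if Nat.testBit j.val (i.val - 1) then -1 else 1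

/-- The Sylvester Hadamard matrix `H_{2^k}`, via `H(i,j) = (-1)^popcount(i AND j)`
(the sum of the binary digits of `i &&& j` is its popcount). -/
def Hsyl (k : ℕ) : Matrix (Fin (2 ^ k)) (Fin (2 ^ k)) ℝ :=
  fun i j => (-1) ^ ((Nat.digits 2 (i.val &&& j.val)).sum)

/-- `CT_m`: the `(m(m-1)/2) × 2^(m-1)` matrix whose `k`-th column is the Column
Pairwise Product of the `k`-th column of `T_m`: its entry in the row at position
`pidx i j` (for the unique pair `i < j` with that position) and column `k` is
`T_m i k * T_m j k`. -/
def CTmat (m : ℕ) : Matrix (Fin (m * (m - 1) / 2)) (Fin (2 ^ (m - 1))) ℝ :=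
  fun p k => ∑ i : Fin m, ∑ j : Fin m,
    if i < j ∧ pidx i.val j.val = p.val then Tmat m i k * Tmat m j k else 0

/-- An `m × n` real matrix is `m`-Hadamardesque if every column is a positive multiple
of some column of `T_m`. -/
def IsHadamardesque {m n : ℕ} (M : Matrix (Fin m) (Fin n) ℝ) : Prop :=
  ∀ k : Fin n, ∃ (p : ℝ) (c : Fin (2 ^ (m - 1))), 0 < p ∧ ∀ i, M i k = p * Tmat m i c

/-- The Column Representation Vector of an (`m`-Hadamardesque) matrix `M`: its `c`-th
coordinate is the sum of `p²` over all columns of `M` equal to `p` times the `c`-th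
column of `T_m` with `p > 0` (for such a column, `p` is its first entry, since the
first entry of each column of `T_m` is `1`), and `0` if no column of `M` is a positive
multiple of the `c`-th column of `T_m`. -/
noncomputable def CRV {m n : ℕ} (hm : 0 < m) (M : Matrix (Fin m) (Fin n) ℝ) :
    Fin (2 ^ (m - 1)) → ℝ :=
  fun c => ∑ k : Fin n,
    if 0 < M ⟨0, hm⟩ k ∧ ∀ i, M i k = M ⟨0, hm⟩ k * Tmat m i c then (M ⟨0, hm⟩ k) ^ 2
    else 0

/-- `RC_m`: the set of rows of `H_{2^(m-1)}` that are not rows of `CT_m`. -/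
def RCset (m : ℕ) : Set (Fin (2 ^ (m - 1)) → ℝ) :=
  {w | (∃ a : Fin (2 ^ (m - 1)), w = Hsyl (m - 1) a) ∧
       ¬∃ p : Fin (m * (m - 1) / 2), w = CTmat m p}

open Finset

/-- The bits of `a : Fin (2 ^ k)` as a Boolean vector. -/
def bitVector (k : ℕ) (a : Fin (2 ^ k)) : Fin k → Bool := fun b => a.val.testBit b

lemma bitVector_bijective (k : ℕ) : Function.Bijective (bitVector k) := by
  rw [Fintype.bijective_iff_injective_and_card]
  refine ⟨fun a a' h => Fin.ext (Nat.eq_of_testBit_eq fun b => ?_), by simp⟩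
  by_cases hb : b < k
  · exact congrFun h ⟨b, hb⟩
  · have hk : 2 ^ k ≤ 2 ^ b := Nat.pow_le_pow_right (by norm_num) (by omega)
    rw [Nat.testBit_lt_two_pow (a.isLt.trans_le hk), Nat.testBit_lt_two_pow (a'.isLt.trans_le hk)]

lemma neg_one_pow_digits_sum (k x : ℕ) (hx : x < 2 ^ k) :
    (-1 : ℝ) ^ (Nat.digits 2 x).sum = ∏ b : Fin k, if x.testBit b then -1 else 1 := by
  induction k generalizing x with
  | zero =>
    obtain rfl : x = 0 := by simpa using hx
    simp
  | succ k ih =>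
    have hdigits : (Nat.digits 2 x).sum = x % 2 + (Nat.digits 2 (x / 2)).sum := by
      rcases Nat.eq_zero_or_pos x with rfl | hpos
      · simp
      · rw [Nat.digits_def' (by norm_num) hpos, List.sum_cons]
    have hlt : x / 2 < 2 ^ k := by rw [pow_succ] at hx; omega
    rw [hdigits, pow_add, ih _ hlt, Fin.prod_univ_succ]
    congr 1
    · rcases Nat.mod_two_eq_zero_or_one x with h | h <;> simp [h]
    · simp [Nat.testBit_succ]

lemma Hsyl_eq_prod (k : ℕ) (a c : Fin (2 ^ k)) :
    Hsyl k a c = ∏ b, if bitVector k a b && bitVector k c b then -1 else 1 := by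
  rw [Hsyl, neg_one_pow_digits_sum k _ (Nat.and_lt_two_pow _ c.isLt)]
  simp [bitVector]

lemma Hsyl_symm (k : ℕ) (a c : Fin (2 ^ k)) : Hsyl k a c = Hsyl k c a := by
  simp only [Hsyl, Nat.land_comm]

/-- The rows of the Sylvester matrix are closed under pointwise multiplication. -/
lemma exists_Hsyl_eq_mul (k : ℕ) (a a' : Fin (2 ^ k)) :
    ∃ d, Hsyl k d = Hsyl k a * Hsyl k a' := by
  obtain ⟨d, hd⟩ := (bitVector_bijective k).2 fun b => bitVector k a b ^^ bitVector k a' b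
  refine ⟨d, funext fun c => ?_⟩
  rw [Pi.mul_apply, Hsyl_eq_prod, Hsyl_eq_prod, Hsyl_eq_prod, ← prod_mul_distrib]
  refine prod_congr rfl fun b _ => ?_
  rw [show bitVector k d b = (bitVector k a b ^^ bitVector k a' b) from congrFun hd b]
  cases bitVector k a b <;> cases bitVector k a' b <;> cases bitVector k c b <;> simp

lemma Hsyl_dotProduct (k : ℕ) (a a' : Fin (2 ^ k)) :
    Hsyl k a ⬝ᵥ Hsyl k a' = if a = a' then 2 ^ k else 0 := by
  have hsum : Hsyl k a ⬝ᵥ Hsyl k a' = ∏ b, ∑ x : Bool,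
      (if bitVector k a b && x then (-1 : ℝ) else 1) *
        if bitVector k a' b && x then -1 else 1 := by
    rw [Fintype.prod_sum, dotProduct]
    refine Fintype.sum_bijective _ (bitVector_bijective k) _ _ fun c => ?_
    rw [Hsyl_eq_prod, Hsyl_eq_prod, prod_mul_distrib]
  rw [hsum]
  split_ifs with h
  · subst h
    rw [prod_congr rfl fun b _ => show _ = (2 : ℝ) by
      cases bitVector k a b <;> norm_num]
    simp
  · obtain ⟨b, hb⟩ := Function.ne_iff.1 ((bitVector_bijective k).1.ne h)
    refine prod_eq_zero (mem_univ b) ?_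
    revert hb
    cases bitVector k a b <;> cases bitVector k a' b <;> simp

/-- Expansion of a vector in the orthogonal basis of rows of the Sylvester matrix. -/
lemma sum_dotProduct_smul_Hsyl (k : ℕ) (v : Fin (2 ^ k) → ℝ) :
    ∑ a, ((2 ^ k : ℝ)⁻¹ * (v ⬝ᵥ Hsyl k a)) • Hsyl k a = v := by
  funext c
  have hdot : ∀ d, ∑ a, Hsyl k a d * Hsyl k a c = if d = c then 2 ^ k else 0 := fun d => by
    rw [← Hsyl_dotProduct, dotProduct]
    exact sum_congr rfl fun a _ => by rw [Hsyl_symm k a, Hsyl_symm k a]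
  simp only [Finset.sum_apply, Pi.smul_apply, smul_eq_mul, dotProduct, mul_assoc, sum_mul, mul_sum]
  rw [sum_comm]
  simp only [← mul_sum, hdot]
  simp [mul_comm (v c)]

/-- Every row of `T_m` is a row of the Sylvester matrix. -/
lemma exists_Hsyl_eq_Tmat (m : ℕ) (i : Fin m) : ∃ a, Hsyl (m - 1) a = Tmat m i := by
  obtain ⟨a, ha⟩ := (bitVector_bijective (m - 1)).2 fun b => decide (b.val + 1 = i.val)
  refine ⟨a, funext fun c => ?_⟩
  rw [Hsyl_eq_prod, ha, Tmat]
  split_ifs with h0 hbit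
  · exact prod_eq_one fun b _ => by simp [h0]
  all_goals
    rw [prod_eq_single (⟨i.val - 1, by omega⟩ : Fin (m - 1))]
    · simp [bitVector, hbit, Nat.sub_add_cancel (Nat.pos_of_ne_zero h0)]
    · intro b _ hb
      have : b.val + 1 ≠ i.val := fun h => hb (Fin.ext (by simp; omega))
      simp [this]
    · simp

lemma exists_Hsyl_eq_Tmat_mul (m : ℕ) (i j : Fin m) :
    ∃ a, Hsyl (m - 1) a = Tmat m i * Tmat m j := by
  obtain ⟨a, ha⟩ := exists_Hsyl_eq_Tmat m i
  obtain ⟨b, hb⟩ := exists_Hsyl_eq_Tmat m j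
  rw [← ha, ← hb]
  exact exists_Hsyl_eq_mul _ a b

lemma pidx_lt_pidx {i j i' j' : ℕ} (hij : i < j) (hjj : j < j') : pidx i j < pidx i' j' :=
  (pidx_lt hij hjj).trans_le (Nat.le_add_right _ _)

lemma pidx_inj {i j i' j' : ℕ} (hij : i < j) (hij' : i' < j') (h : pidx i j = pidx i' j') :
    i = i' ∧ j = j' := by
  rcases lt_trichotomy j j' with hj | rfl | hj
  · exact absurd h (pidx_lt_pidx hij hj).ne
  · exact ⟨Nat.add_left_cancel h, rfl⟩
  · exact absurd h (pidx_lt_pidx hij' hj).ne'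

lemma CTmat_pidx {m : ℕ} {i j : Fin m} (hij : i < j) :
    CTmat m ⟨pidx i j, pidx_lt hij j.isLt⟩ = Tmat m i * Tmat m j := by
  funext c
  rw [CTmat, sum_eq_single i, sum_eq_single j]
  · simp [hij]
  · intro j' _ hj'
    exact if_neg fun h => hj' (Fin.ext (pidx_inj h.1 hij h.2).2)
  · simp
  · intro i' _ hi'
    exact sum_eq_zero fun j' _ => if_neg fun h => hi' (Fin.ext (pidx_inj h.1 hij h.2).1)
  · simp

lemma dotProduct_CTmat_eq_zero {m : ℕ} {v : Fin (2 ^ (m - 1)) → ℝ}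
    (hv : ∀ i j : Fin m, i ≠ j → v ⬝ᵥ (Tmat m i * Tmat m j) = 0) (p : Fin (m * (m - 1) / 2)) :
    v ⬝ᵥ CTmat m p = 0 := by
  have hCT : CTmat m p = ∑ i : Fin m, ∑ j : Fin m,
      if i < j ∧ pidx i.val j.val = p.val then Tmat m i * Tmat m j else 0 := by
    funext c
    simp only [CTmat, Finset.sum_apply]
    refine sum_congr rfl fun i _ => sum_congr rfl fun j _ => ?_
    split_ifs <;> simp
  simp only [hCT, dotProduct_sum]
  refine sum_eq_zero fun i _ => sum_eq_zero fun j _ => ?_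
  split_ifs with h
  · exact hv i j h.1.ne
  · simp

lemma mem_span_RCset_iff (m : ℕ) (v : Fin (2 ^ (m - 1)) → ℝ) :
    v ∈ Submodule.span ℝ (RCset m) ↔
      ∀ i j : Fin m, i ≠ j → v ⬝ᵥ (Tmat m i * Tmat m j) = 0 := by
  constructor
  · intro hv
    have key : ∀ i j : Fin m, i < j → v ⬝ᵥ (Tmat m i * Tmat m j) = 0 := by
      intro i j hij
      obtain ⟨a, ha⟩ := exists_Hsyl_eq_Tmat_mul m i j
      induction hv using Submodule.span_induction with
      | mem w hw =>
        obtain ⟨⟨b, rfl⟩, hb⟩ := hw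
        rw [← ha, Hsyl_dotProduct, if_neg]
        rintro rfl
        exact hb ⟨_, ha.trans (CTmat_pidx hij).symm⟩
      | zero => simp
      | add x y _ _ hx hy => rw [add_dotProduct, hx, hy, add_zero]
      | smul r x _ hx => rw [smul_dotProduct, hx, smul_zero]
    intro i j hij
    rcases lt_or_gt_of_ne hij with h | h
    · exact key i j h
    · rw [mul_comm]
      exact key j i h
  · intro hv
    rw [← sum_dotProduct_smul_Hsyl _ v]
    refine Submodule.sum_mem _ fun a _ => ?_
    by_cases ha : ∃ p, Hsyl (m - 1) a = CTmat m p
    · obtain ⟨p, hp⟩ := ha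
      rw [hp, dotProduct_CTmat_eq_zero hv, mul_zero, zero_smul]
      exact Submodule.zero_mem _
    · exact Submodule.smul_mem _ _ (Submodule.subset_span ⟨⟨a, rfl⟩, ha⟩)

lemma Tmat_col_injective (m : ℕ) (c c' : Fin (2 ^ (m - 1)))
    (h : ∀ i, Tmat m i c = Tmat m i c') : c = c' := by
  refine (bitVector_bijective (m - 1)).1 (funext fun b => ?_)
  have hb := h ⟨b.val + 1, by omega⟩
  simp only [Tmat, Nat.succ_ne_zero, if_false, Nat.add_sub_cancel] at hb
  simp only [bitVector]
  revert hb
  cases c.val.testBit b <;> cases c'.val.testBit b <;> norm_num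

/-- Every `±1` vector with first entry `1` is a column of `T_m`. -/
lemma exists_Tmat_col_eq {m : ℕ} (hm : 0 < m) (u : Fin m → ℝ)
    (hu : ∀ i, u i = 1 ∨ u i = -1) (hu0 : u ⟨0, hm⟩ = 1) : ∃ c, ∀ i, u i = Tmat m i c := by
  obtain ⟨c, hc⟩ := (bitVector_bijective (m - 1)).2
    fun b => decide (u ⟨b.val + 1, by omega⟩ = -1)
  refine ⟨c, fun i => ?_⟩
  obtain ⟨i, hi⟩ := i
  cases i with
  | zero => simpa [Tmat] using hu0
  | succ i =>
    have hbit : c.val.testBit i = decide (u ⟨i + 1, hi⟩ = -1) :=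
      congrFun hc ⟨i, by omega⟩
    rcases hu ⟨i + 1, hi⟩ with h | h <;> norm_num [Tmat, hbit, h]

/-- For `m ≥ 2`, let `M` be an `m × n` matrix all of whose entries are `±1`, whose
first row is the all-ones vector, and whose columns are pairwise distinct.  Then `M`
is `m`-Hadamardesque, its Column Representation Vector `v` is a 0-1 vector with
exactly `n` ones, and: the rows of `M` are pairwise orthogonal (i.e. `M` is a partial
Hadamard matrix) iff `v` lies in the span of `RC_m`. -/
theorem partial_hadamard_iff_crv_mem_span (m n : ℕ) (hm : 2 ≤ m)
    (M : Matrix (Fin m) (Fin n) ℝ)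
    (hpm : ∀ i j, M i j = 1 ∨ M i j = -1)
    (hrow0 : ∀ k, M ⟨0, by omega⟩ k = 1)
    (hcols : ∀ k k' : Fin n, k ≠ k' → (fun i => M i k) ≠ (fun i => M i k')) :
    IsHadamardesque M ∧
    (∀ c, CRV (by omega : 0 < m) M c = 0 ∨ CRV (by omega : 0 < m) M c = 1) ∧
    (Finset.univ.filter fun c => CRV (by omega : 0 < m) M c = 1).card = n ∧
    ((∀ i j : Fin m, i ≠ j → M i ⬝ᵥ M j = 0) ↔
      CRV (by omega : 0 < m) M ∈ Submodule.span ℝ (RCset m)) := by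
  obtain ⟨c, hc⟩ : ∃ c : Fin n → Fin (2 ^ (m - 1)), ∀ k i, M i k = Tmat m i (c k) :=
    ⟨_, fun k => (exists_Tmat_col_eq (by omega) (fun i => M i k) (fun i => hpm i k)
      (hrow0 k)).choose_spec⟩
  have hinj : Function.Injective c := fun k k' h => by
    by_contra hk
    exact hcols k k' hk (funext fun i => by rw [hc, hc, h])
  have hcrv : ∀ d, CRV (by omega : 0 < m) M d = ∑ k, if c k = d then 1 else 0 := fun d => by
    refine sum_congr rfl fun k _ => ?_
    have hiff : (∀ i, M i k = Tmat m i d) ↔ c k = d :=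
      ⟨fun h => Tmat_col_injective m _ _ fun i => by rw [← hc, h], fun h i => by rw [hc, h]⟩
    simp [hrow0, hiff]
  have hcrv_image : ∀ d, CRV (by omega : 0 < m) M d = if d ∈ univ.image c then 1 else 0 := by
    intro d
    rw [hcrv]
    split_ifs with h
    · obtain ⟨k, -, rfl⟩ := mem_image.1 h
      simp [hinj.eq_iff]
    · exact sum_eq_zero fun k _ => if_neg fun hk => h (mem_image.2 ⟨k, mem_univ k, hk⟩)
  refine ⟨fun k => ⟨1, c k, one_pos, fun i => by rw [hc, one_mul]⟩, fun d => ?_, ?_, ?_⟩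
  · rw [hcrv_image]
    split_ifs <;> simp
  · have hfilter : (univ.filter fun d => CRV (by omega : 0 < m) M d = 1) = univ.image c := by
      ext d
      simp only [mem_filter, mem_univ, true_and, hcrv_image]
      split_ifs with h <;> simp [h]
    rw [hfilter, card_image_of_injective _ hinj, card_univ, Fintype.card_fin]
  · rw [mem_span_RCset_iff]
    refine forall₃_congr fun i j _ => ?_
    have hdot : CRV (by omega : 0 < m) M ⬝ᵥ (Tmat m i * Tmat m j) = M i ⬝ᵥ M j := by
      simp only [dotProduct, hcrv, sum_mul, hc]
      rw [sum_comm]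
      simp
    rw [hdot]
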